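/- Let b > 0, let w be a weight function satisfying conditions (i) and (ii), and let k ∈ L¹(0,b) satisfy the weighted Sonine condition WSC1 with weight w, associated kernel K ∈ L¹(0,b), and function g. Suppose f ∈ W^{1,1}(0,b). Then the first-kind Volterra integral equation ∫₀ᵗ K(t−s) u(s) ds = f(t) for almost every t ∈ (0,b] admits a unique solution u ∈ L¹(0,b). -/

import Mathlib

open MeasureTheory

/-- Weight condition (i): `w(t,t)` is bounded away from zero and bounded on `[0,b]`. -/
def WeightCondI (b : ℝ) (w : ℝ → ℝ → ℝ) : Prop :=
  ∃ μlo μhi : ℝ, 0 < μlo ∧ μlo ≤ μhi ∧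
    ∀ t ∈ Set.Icc (0:ℝ) b, μlo ≤ |w t t| ∧ |w t t| ≤ μhi

/-- Weight condition (ii): `w` is differentiable in its second variable with
`|∂₂w(s,t)| ≤ w̄(t-s)` for some nonnegative `w̄ ∈ L¹(0,b)`. -/
def WeightCondII (b : ℝ) (w : ℝ → ℝ → ℝ) : Prop :=
  ∃ w₂ : ℝ → ℝ → ℝ, ∃ wbar : ℝ → ℝ,
    (∀ x, 0 ≤ wbar x) ∧ IntegrableOn wbar (Set.Ioc 0 b) ∧
    ∀ s t : ℝ, 0 ≤ s → s ≤ t → t ≤ b →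
      HasDerivWithinAt (fun y => w s y) (w₂ s t) (Set.Icc s b) t ∧ |w₂ s t| ≤ wbar (t - s)

/-- The weighted Sonine condition WSC1 for a kernel `k ∈ L¹(0,b)` with weight `w`, associated
kernel `K ∈ L¹(0,b)`, and function `g` (with partial derivative `g₂` in the second variable
dominated by `gbar ∈ L¹(0,b)`): `∫₀ᵗ w(s,z+s) K(t-z) k(z) dz = g(s,t)` for `0 ≤ s + t ≤ b`
(`t > 0`), where `g` satisfies conditions (a) and (b). -/
def WSC1 (b : ℝ) (w : ℝ → ℝ → ℝ) (k K : ℝ → ℝ)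
    (g g₂ : ℝ → ℝ → ℝ) (gbar : ℝ → ℝ) : Prop :=
  IntegrableOn k (Set.Ioc 0 b) ∧ IntegrableOn K (Set.Ioc 0 b) ∧
  (∀ s t : ℝ, 0 ≤ s → 0 < t → s + t ≤ b →
    (∫ z in (0:ℝ)..t, w s (z + s) * K (t - z) * k z) = g s t) ∧
  (∃ νlo νhi : ℝ, 0 < νlo ∧ νlo ≤ νhi ∧
    ∀ s ∈ Set.Icc (0:ℝ) b, νlo ≤ |g s 0| ∧ |g s 0| ≤ νhi) ∧
  (∀ x, 0 ≤ gbar x) ∧ IntegrableOn gbar (Set.Ioc 0 b) ∧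
  (∀ s t : ℝ, 0 ≤ s → 0 ≤ t → s + t ≤ b →
    HasDerivWithinAt (fun τ => g s τ) (g₂ s t) (Set.Icc 0 (b - s)) t ∧ |g₂ s t| ≤ gbar t)

namespace TruncConv

open Set Filter Topology

/-- Convolution of the restrictions of `f` and `g` to `(0, b]`, extended by zero to the line. -/
noncomputable def tconv (b : ℝ) (f g : ℝ → ℝ) : ℝ → ℝ :=
  convolution ((Ioc 0 b).indicator f) ((Ioc 0 b).indicator g) (ContinuousLinearMap.mul ℝ ℝ) volume

variable {b : ℝ} {f g h f₁ g₁ : ℝ → ℝ}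

theorem tconv_apply (x : ℝ) :
    tconv b f g x = ∫ t, (Ioc 0 b).indicator f t * (Ioc 0 b).indicator g (x - t) := rfl

theorem indicator_ae_eq (hf : f =ᵐ[volume.restrict (Ioc 0 b)] f₁) :
    (Ioc 0 b).indicator f =ᵐ[volume] (Ioc 0 b).indicator f₁ :=
  (ae_eq_restrict_iff_indicator_ae_eq measurableSet_Ioc).1 hf

theorem tconv_congr (hf : f =ᵐ[volume.restrict (Ioc 0 b)] f₁)
    (hg : g =ᵐ[volume.restrict (Ioc 0 b)] g₁) : tconv b f g = tconv b f₁ g₁ :=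
  convolution_congr _ (indicator_ae_eq hf) (indicator_ae_eq hg)

theorem tconv_comm (f g : ℝ → ℝ) : tconv b f g = tconv b g f := by
  ext x
  rw [tconv, convolution_mul_swap, tconv_apply]
  simp only [mul_comm]

theorem integrable_tconv (hf : IntegrableOn f (Ioc 0 b)) (hg : IntegrableOn g (Ioc 0 b)) :
    Integrable (tconv b f g) :=
  ((integrable_indicator_iff measurableSet_Ioc).2 hf).integrable_convolution _
    ((integrable_indicator_iff measurableSet_Ioc).2 hg)

theorem tconv_add (hf : IntegrableOn f (Ioc 0 b)) (hg : IntegrableOn g (Ioc 0 b))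
    (hh : IntegrableOn h (Ioc 0 b)) :
    tconv b f (g + h) =ᵐ[volume] tconv b f g + tconv b f h := by
  have hf' := (integrable_indicator_iff measurableSet_Ioc).2 hf
  have hg' := (integrable_indicator_iff measurableSet_Ioc).2 hg
  have hh' := (integrable_indicator_iff measurableSet_Ioc).2 hh
  filter_upwards [hf'.ae_convolution_exists (ContinuousLinearMap.mul ℝ ℝ) hg',
    hf'.ae_convolution_exists (ContinuousLinearMap.mul ℝ ℝ) hh'] with x hx hx'
  rw [tconv, indicator_add']
  exact hx.distrib_add hx'

theorem tconv_smul (c : ℝ) (f g : ℝ → ℝ) : tconv b f (c • g) = c • tconv b f g := by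
  have : (Ioc 0 b).indicator (c • g) = c • (Ioc 0 b).indicator g :=
    indicator_const_smul (Ioc 0 b) c g
  rw [tconv, this]
  exact convolution_smul

theorem tconv_eq_intervalIntegral {x : ℝ} (hx : x ∈ Ioc 0 b) :
    tconv b f g x = ∫ t in (0 : ℝ)..x, f (x - t) * g t := by
  rw [tconv_comm, tconv_apply, intervalIntegral.integral_of_le hx.1.le,
    integral_Ioc_eq_integral_Ioo, ← integral_indicator measurableSet_Ioo]
  congr 1 with t
  simp only [indicator, mem_Ioc, mem_Ioo] at hx ⊢
  split_ifs <;> grind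

theorem tconv_eq_zero {x : ℝ} (hx : x ≤ 0) : tconv b f g x = 0 := by
  rw [tconv_apply]
  refine integral_eq_zero_of_ae (Eventually.of_forall fun t => ?_)
  simp only [indicator, mem_Ioc]
  split_ifs <;> simp only [Pi.zero_apply] <;> grind

theorem tconv_eq_convolution_of_nonpos {F : ℝ → ℝ} (hF : ∀ x ≤ 0, F x = 0) {x : ℝ} (hx : x ≤ b) :
    tconv b F g x =
      convolution F ((Ioc 0 b).indicator g) (ContinuousLinearMap.mul ℝ ℝ) volume x := by
  rw [tconv_apply, convolution_mul]
  congr 1 with t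
  simp only [indicator, mem_Ioc]
  split_ifs <;> grind

theorem tconv_assoc (hf : IntegrableOn f (Ioc 0 b)) (hg : IntegrableOn g (Ioc 0 b))
    (hh : IntegrableOn h (Ioc 0 b)) :
    tconv b (tconv b f g) h =ᵐ[volume.restrict (Ioc 0 b)] tconv b f (tconv b g h) := by
  have hf' := (integrable_indicator_iff measurableSet_Ioc).2 hf
  have hg' := (integrable_indicator_iff measurableSet_Ioc).2 hg
  have hh' := (integrable_indicator_iff measurableSet_Ioc).2 hh
  have key := hf'.norm.ae_convolution_exists (ContinuousLinearMap.mul ℝ ℝ)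
    (hg'.norm.integrable_convolution (ContinuousLinearMap.mul ℝ ℝ) hh'.norm)
  filter_upwards [ae_restrict_of_ae key, ae_restrict_mem measurableSet_Ioc] with x hx hxb
  rw [tconv_comm f (tconv b g h), tconv_eq_convolution_of_nonpos (fun _ => tconv_eq_zero) hxb.2,
    tconv_eq_convolution_of_nonpos (fun _ => tconv_eq_zero) hxb.2]
  refine (convolution_assoc (ContinuousLinearMap.mul ℝ ℝ) (ContinuousLinearMap.mul ℝ ℝ)
    (ContinuousLinearMap.mul ℝ ℝ) (ContinuousLinearMap.mul ℝ ℝ) (fun x y z => mul_assoc x y z)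
    hf'.aestronglyMeasurable hg'.aestronglyMeasurable hh'.aestronglyMeasurable
    (hf'.ae_convolution_exists _ hg') (hg'.norm.ae_convolution_exists _ hh'.norm) hx).trans ?_
  rw [convolution_mul_swap, convolution_mul]
  simp only [mul_comm, tconv]

theorem exp_mul_tconv (c x : ℝ) (f g : ℝ → ℝ) :
    Real.exp (c * x) * tconv b f g x =
      tconv b (fun t => Real.exp (c * t) * f t) (fun t => Real.exp (c * t) * g t) x := by
  rw [tconv_apply, tconv_apply, ← integral_const_mul]
  congr 1 with t
  have : Real.exp (c * x) = Real.exp (c * t) * Real.exp (c * (x - t)) := by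
    rw [← Real.exp_add]; ring_nf
  simp only [indicator, mem_Ioc, this]
  split_ifs <;> ring

theorem setIntegral_norm_tconv_le (hf : IntegrableOn f (Ioc 0 b)) (hg : IntegrableOn g (Ioc 0 b)) :
    ∫ x in Ioc 0 b, ‖tconv b f g x‖ ≤ (∫ x in Ioc 0 b, ‖f x‖) * ∫ x in Ioc 0 b, ‖g x‖ := by
  have hf' := ((integrable_indicator_iff measurableSet_Ioc).2 hf).norm
  have hg' := ((integrable_indicator_iff measurableSet_Ioc).2 hg).norm
  have key := integral_convolution (ContinuousLinearMap.mul ℝ ℝ) hf' hg'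
  simp only [norm_indicator_eq_indicator_norm, integral_indicator measurableSet_Ioc,
    ContinuousLinearMap.mul_apply'] at key
  rw [← key]
  refine (setIntegral_le_integral (integrable_tconv hf hg).norm
    (Eventually.of_forall fun _ => norm_nonneg _)).trans ?_
  refine integral_mono (integrable_tconv hf hg).norm
    (by simpa only [norm_indicator_eq_indicator_norm] using
      hf'.integrable_convolution (ContinuousLinearMap.mul ℝ ℝ) hg') fun x => ?_
  rw [tconv_apply, convolution_mul]
  refine (norm_integral_le_integral_norm _).trans_eq ?_
  simp only [norm_mul, norm_indicator_eq_indicator_norm]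

/-- Convolution on `L¹(0, b)`. -/
noncomputable def conv (x y : ℝ →₁[volume.restrict (Ioc 0 b)] ℝ) :
    ℝ →₁[volume.restrict (Ioc 0 b)] ℝ :=
  Integrable.toL1 (tconv b x y)
    (integrable_tconv (L1.integrable_coeFn x) (L1.integrable_coeFn y)).integrableOn

theorem coeFn_conv (x y : ℝ →₁[volume.restrict (Ioc 0 b)] ℝ) :
    conv x y =ᵐ[volume.restrict (Ioc 0 b)] tconv b x y :=
  Integrable.coeFn_toL1 _

theorem conv_toL1 (hf : Integrable f (volume.restrict (Ioc 0 b)))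
    (hg : Integrable g (volume.restrict (Ioc 0 b))) :
    conv (Integrable.toL1 f hf) (Integrable.toL1 g hg) =ᵐ[volume.restrict (Ioc 0 b)]
      tconv b f g :=
  (coeFn_conv _ _).trans (tconv_congr hf.coeFn_toL1 hg.coeFn_toL1).eventuallyEq

theorem conv_comm (x y : ℝ →₁[volume.restrict (Ioc 0 b)] ℝ) : conv x y = conv y x := by
  simp only [conv, tconv_comm]

theorem conv_add (x y z : ℝ →₁[volume.restrict (Ioc 0 b)] ℝ) :
    conv x (y + z) = conv x y + conv x z := by
  refine Lp.ext ((coeFn_conv _ _).trans ?_)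
  rw [tconv_congr (ae_eq_refl _) (Lp.coeFn_add y z)]
  have h₁ : tconv b x (y + z) =ᵐ[volume.restrict (Ioc 0 b)] tconv b x y + tconv b x z :=
    ae_restrict_of_ae (tconv_add (L1.integrable_coeFn x) (L1.integrable_coeFn y)
      (L1.integrable_coeFn z))
  refine h₁.trans ?_
  exact (EventuallyEq.add (coeFn_conv x y).symm (coeFn_conv x z).symm).trans (Lp.coeFn_add _ _).symm

theorem conv_smul (c : ℝ) (x y : ℝ →₁[volume.restrict (Ioc 0 b)] ℝ) :
    conv x (c • y) = c • conv x y := by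
  refine Lp.ext ((coeFn_conv _ _).trans ?_)
  rw [tconv_congr (ae_eq_refl _) (Lp.coeFn_smul c y), tconv_smul]
  exact (EventuallyEq.const_smul (coeFn_conv x y).symm c).trans (Lp.coeFn_smul _ _).symm

theorem conv_assoc (x y z : ℝ →₁[volume.restrict (Ioc 0 b)] ℝ) :
    conv (conv x y) z = conv x (conv y z) := by
  refine Lp.ext ((coeFn_conv _ _).trans ?_)
  rw [tconv_congr (coeFn_conv x y) (ae_eq_refl _)]
  refine (tconv_assoc (L1.integrable_coeFn x) (L1.integrable_coeFn y)
    (L1.integrable_coeFn z)).trans ?_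
  rw [← tconv_congr (ae_eq_refl _) (coeFn_conv y z)]
  exact (coeFn_conv _ _).symm

theorem conv_zero (x : ℝ →₁[volume.restrict (Ioc 0 b)] ℝ) : conv x 0 = 0 := by
  simpa using conv_smul 0 x 0

theorem conv_sub (x y z : ℝ →₁[volume.restrict (Ioc 0 b)] ℝ) :
    conv x (y - z) = conv x y - conv x z := by
  rw [eq_sub_iff_add_eq, ← conv_add, sub_add_cancel]

theorem norm_conv_le (x y : ℝ →₁[volume.restrict (Ioc 0 b)] ℝ) :
    ‖conv x y‖ ≤ ‖x‖ * ‖y‖ := by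
  rw [L1.norm_eq_integral_norm, L1.norm_eq_integral_norm, L1.norm_eq_integral_norm,
    integral_congr_ae ((coeFn_conv x y).mono fun _ => congrArg norm)]
  exact setIntegral_norm_tconv_le (L1.integrable_coeFn x) (L1.integrable_coeFn y)

theorem integrableOn_exp_mul (c : ℝ) (hf : IntegrableOn f (Ioc 0 b)) :
    IntegrableOn (fun t => Real.exp (c * t) * f t) (Ioc 0 b) := by
  rw [← integrableOn_Icc_iff_integrableOn_Ioc] at hf ⊢
  exact hf.continuousOn_mul (by fun_prop) isCompact_Icc

/-- Multiplication by `t ↦ exp (c * t)` on `L¹(0, b)`. -/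
noncomputable def expMul (c : ℝ) (x : ℝ →₁[volume.restrict (Ioc 0 b)] ℝ) :
    ℝ →₁[volume.restrict (Ioc 0 b)] ℝ :=
  Integrable.toL1 _ (integrableOn_exp_mul c (L1.integrable_coeFn x))

theorem coeFn_expMul (c : ℝ) (x : ℝ →₁[volume.restrict (Ioc 0 b)] ℝ) :
    expMul c x =ᵐ[volume.restrict (Ioc 0 b)] fun t => Real.exp (c * t) * x t :=
  Integrable.coeFn_toL1 _

theorem expMul_add (c : ℝ) (x y : ℝ →₁[volume.restrict (Ioc 0 b)] ℝ) :
    expMul c (x + y) = expMul c x + expMul c y := by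
  refine Lp.ext ?_
  filter_upwards [coeFn_expMul c (x + y), coeFn_expMul c x, coeFn_expMul c y, Lp.coeFn_add x y,
    Lp.coeFn_add (expMul c x) (expMul c y)] with t h₁ h₂ h₃ h₄ h₅
  simp only [h₁, h₂, h₃, h₄, h₅, Pi.add_apply, mul_add]

theorem expMul_expMul_neg (c : ℝ) (x : ℝ →₁[volume.restrict (Ioc 0 b)] ℝ) :
    expMul c (expMul (-c) x) = x := by
  refine Lp.ext ?_
  filter_upwards [coeFn_expMul c (expMul (-c) x), coeFn_expMul (-c) x] with t h₁ h₂
  rw [h₁, h₂, ← mul_assoc, ← Real.exp_add]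
  simp

theorem expMul_conv (c : ℝ) (x y : ℝ →₁[volume.restrict (Ioc 0 b)] ℝ) :
    expMul c (conv x y) = conv (expMul c x) (expMul c y) := by
  refine Lp.ext ?_
  filter_upwards [coeFn_expMul c (conv x y), coeFn_conv x y,
    coeFn_conv (expMul c x) (expMul c y)] with t h₁ h₂ h₃
  rw [h₁, h₂, h₃, exp_mul_tconv, tconv_congr (coeFn_expMul c x) (coeFn_expMul c y)]

theorem tendsto_norm_expMul (x : ℝ →₁[volume.restrict (Ioc 0 b)] ℝ) :
    Tendsto (fun n : ℕ => ‖expMul (-(n : ℝ)) x‖) atTop (𝓝 0) := by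
  have h₁ : ∀ n : ℕ, ‖expMul (-(n : ℝ)) x‖ = ∫ t in Ioc 0 b, ‖Real.exp (-(n : ℝ) * t) * x t‖ :=
    fun n => by
      rw [L1.norm_eq_integral_norm, integral_congr_ae ((coeFn_expMul _ x).mono fun _ => congrArg norm)]
  simp only [h₁]
  suffices Tendsto (fun n : ℕ => ∫ t in Ioc 0 b, ‖Real.exp (-(n : ℝ) * t) * x t‖) atTop
      (𝓝 (∫ t in Ioc 0 b, (0 : ℝ))) by simpa only [integral_zero] using this
  refine tendsto_integral_of_dominated_convergence (fun t => ‖x t‖)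
    (fun n => (integrableOn_exp_mul _ (L1.integrable_coeFn x)).aestronglyMeasurable.norm)
    (L1.integrable_coeFn x).norm (fun n => ?_) ?_
  · filter_upwards [ae_restrict_mem measurableSet_Ioc] with t ht
    rw [norm_norm, norm_mul, Real.norm_eq_abs, Real.abs_exp]
    refine mul_le_of_le_one_left (norm_nonneg _) (Real.exp_le_one_iff.2 ?_)
    have : 0 ≤ (n : ℝ) * t := mul_nonneg n.cast_nonneg ht.1.le
    linarith
  · filter_upwards [ae_restrict_mem measurableSet_Ioc] with t ht
    have h₂ : Tendsto (fun n : ℕ => -(n : ℝ) * t) atTop atBot :=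
      (tendsto_neg_atTop_atBot.comp tendsto_natCast_atTop_atTop).atBot_mul_const ht.1
    simpa using ((Real.tendsto_exp_atBot.comp h₂).mul_const (x t)).norm

theorem bijective_add_conv_of_norm_lt_one {h : ℝ →₁[volume.restrict (Ioc 0 b)] ℝ}
    (hh : ‖h‖ < 1) : Function.Bijective fun x => x + conv h x := by
  have key : ∀ a, ContractingWith ‖h‖₊ fun x => a - conv h x := fun a =>
    ⟨by exact_mod_cast hh, LipschitzWith.of_dist_le_mul fun x y => by
      rw [dist_sub_left, dist_eq_norm, dist_eq_norm, ← conv_sub]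
      exact norm_conv_le _ _⟩
  refine ⟨fun x y hxy => ?_, fun a => ⟨(key a).fixedPoint, ?_⟩⟩
  · refine (key (x + conv h x)).fixedPoint_unique' (add_sub_cancel_right _ _) ?_
    simp only at hxy
    rw [hxy]
    exact add_sub_cancel_right _ _
  · exact (sub_eq_iff_eq_add.1 (key a).fixedPoint_isFixedPt).symm

/-- Unique solvability in `L¹(0, b)` of the Volterra equation of the second kind. -/
theorem bijective_add_conv (h : ℝ →₁[volume.restrict (Ioc 0 b)] ℝ) :
    Function.Bijective fun x => x + conv h x := by
  obtain ⟨n, hn⟩ := ((tendsto_norm_expMul h).eventually_lt_const one_pos).exists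
  have hB := bijective_add_conv_of_norm_lt_one hn
  have hinv : ∀ x : ℝ →₁[volume.restrict (Ioc 0 b)] ℝ, expMul n (expMul (-n) x) = x :=
    expMul_expMul_neg _
  have hinv' : ∀ x : ℝ →₁[volume.restrict (Ioc 0 b)] ℝ, expMul (-n) (expMul n x) = x := fun x => by
    simpa using expMul_expMul_neg (-(n : ℝ)) x
  have hE : Function.Bijective
      (expMul n : (ℝ →₁[volume.restrict (Ioc 0 b)] ℝ) → ℝ →₁[volume.restrict (Ioc 0 b)] ℝ) :=
    ⟨Function.LeftInverse.injective hinv', Function.RightInverse.surjective hinv⟩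
  have hE' : Function.Bijective
      (expMul (-n) : (ℝ →₁[volume.restrict (Ioc 0 b)] ℝ) → ℝ →₁[volume.restrict (Ioc 0 b)] ℝ) :=
    ⟨Function.LeftInverse.injective hinv, Function.RightInverse.surjective hinv'⟩
  convert (hE.comp hB).comp hE' using 1
  ext1 x
  simp only [Function.comp_apply, ← expMul_conv, ← expMul_add, hinv]

theorem bijective_smul_add_conv {c : ℝ} (hc : c ≠ 0)
    (h : ℝ →₁[volume.restrict (Ioc 0 b)] ℝ) : Function.Bijective fun x => c • x + conv h x := by
  convert (MulAction.bijective (Units.mk0 c hc)).comp (bijective_add_conv (c⁻¹ • h)) using 1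
  ext1 x
  simp only [Function.comp_apply, Units.smul_mk0, smul_add, conv_comm _ x, conv_smul,
    smul_inv_smul₀ hc]

/-- The constant function `1` in `L¹(0, b)`. -/
noncomputable def one (b : ℝ) : ℝ →₁[volume.restrict (Ioc 0 b)] ℝ :=
  Integrable.toL1 (fun _ => 1) (integrable_const _)

theorem conv_one_toL1 (hf : Integrable f (volume.restrict (Ioc 0 b))) :
    conv (one b) (Integrable.toL1 f hf) =ᵐ[volume.restrict (Ioc 0 b)]
      fun t => ∫ s in (0 : ℝ)..t, f s := by
  refine (conv_toL1 _ hf).trans ?_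
  filter_upwards [ae_restrict_mem measurableSet_Ioc] with t ht
  simp only [tconv_eq_intervalIntegral ht, one_mul]

theorem ae_eq_zero_of_integral_ae_eq_zero (hf : IntegrableOn f (Ioc 0 b))
    (h : (fun t => ∫ s in (0 : ℝ)..t, f s) =ᵐ[volume.restrict (Ioc 0 b)] fun _ => 0) :
    f =ᵐ[volume.restrict (Ioc 0 b)] fun _ => 0 := by
  rcases le_or_gt b 0 with hb | hb
  · simp [Ioc_eq_empty hb.not_gt, EventuallyEq]
  have hint : IntervalIntegrable f volume 0 b :=
    (intervalIntegrable_iff_integrableOn_Ioc_of_le hb.le).2 hf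
  have hcont : ContinuousOn (fun t => ∫ s in (0 : ℝ)..t, f s) (Ioo 0 b) := by
    refine (intervalIntegral.continuousOn_primitive_interval ?_).mono
      (Ioo_subset_Icc_self.trans Icc_subset_uIcc)
    rwa [uIcc_of_le hb.le, integrableOn_Icc_iff_integrableOn_Ioc]
  rw [Measure.restrict_congr_set (Ioo_ae_eq_Ioc (μ := volume) (a := 0) (b := b)).symm] at h ⊢
  have hF := Measure.eqOn_open_of_ae_eq h isOpen_Ioo hcont continuousOn_const
  filter_upwards [ae_restrict_of_ae hint.ae_hasDerivAt_integral, ae_restrict_mem measurableSet_Ioo]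
    with t ht htb
  refine (ht (Icc_subset_uIcc (Ioo_subset_Icc_self htb)) 0 left_mem_uIcc).unique ?_
  exact (hasDerivAt_const t (0 : ℝ)).congr_of_eventuallyEq
    (eventually_of_mem (Ioo_mem_nhds htb.1 htb.2) hF)

theorem eq_zero_of_conv_one_eq_zero {x : ℝ →₁[volume.restrict (Ioc 0 b)] ℝ}
    (hx : conv (one b) x = 0) : x = 0 := by
  have h₁ := conv_one_toL1 (L1.integrable_coeFn x)
  rw [Integrable.toL1_coeFn, hx] at h₁
  exact Lp.ext ((ae_eq_zero_of_integral_ae_eq_zero (L1.integrable_coeFn x)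
    (h₁.symm.trans (Lp.coeFn_zero _ _ _))).trans (Lp.coeFn_zero _ _ _).symm)

section Algebra

variable {p q d : ℝ →₁[volume.restrict (Ioc 0 b)] ℝ} {c : ℝ}

theorem conv_conv_eq (hpq : conv p q = c • one b + conv (one b) d)
    (x : ℝ →₁[volume.restrict (Ioc 0 b)] ℝ) :
    conv q (conv p x) = conv (one b) (c • x + conv d x) := by
  rw [← conv_assoc, conv_comm q, hpq, conv_comm, conv_add, conv_smul, conv_add, conv_smul,
    conv_comm x, conv_comm x, conv_assoc]

theorem injective_conv (hc : c ≠ 0) (hpq : conv p q = c • one b + conv (one b) d) :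
    Function.Injective (conv p) := by
  intro x y hxy
  have h₁ : conv q (conv p (x - y)) = 0 := by rw [conv_sub, hxy, sub_self, conv_zero]
  rw [conv_conv_eq hpq] at h₁
  refine sub_eq_zero.1 ((bijective_smul_add_conv hc d).injective ?_)
  simp only [eq_zero_of_conv_one_eq_zero h₁, smul_zero, conv_zero, add_zero]

/-- If the convolution of `p` and `q` has an integrable derivative and a nonzero initial value,
then convolution with `p` reaches every absolutely continuous function. -/
theorem exists_conv_eq (hc : c ≠ 0) (hpq : conv p q = c • one b + conv (one b) d) (a : ℝ)
    (y : ℝ →₁[volume.restrict (Ioc 0 b)] ℝ) :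
    ∃ u, conv p u = a • one b + conv (one b) y := by
  obtain ⟨u, hu⟩ := (bijective_smul_add_conv hc d).surjective (a • q + conv q y)
  simp only at hu
  refine ⟨u, injective_conv hc ((conv_comm q p).trans hpq) ?_⟩
  rw [conv_conv_eq hpq, hu, conv_add, conv_add, conv_smul, conv_smul, conv_comm q (one b),
    ← conv_assoc, ← conv_assoc, conv_comm q]

end Algebra

theorem toL1_eq_smul_one_add {F F' : ℝ → ℝ} (hF : Integrable F (volume.restrict (Ioc 0 b)))
    (hF' : Integrable F' (volume.restrict (Ioc 0 b))) {c : ℝ}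
    (h : ∀ t ∈ Ioc 0 b, F t = c + ∫ s in (0 : ℝ)..t, F' s) :
    Integrable.toL1 F hF = c • one b + conv (one b) (Integrable.toL1 F' hF') := by
  refine Lp.ext (hF.coeFn_toL1.trans ?_)
  filter_upwards [ae_restrict_mem measurableSet_Ioc, conv_one_toL1 hF',
    Lp.coeFn_add (c • one b) (conv (one b) (Integrable.toL1 F' hF')), Lp.coeFn_smul c (one b),
    (integrable_const (μ := volume.restrict (Ioc 0 b)) (1 : ℝ)).coeFn_toL1] with t ht h₁ h₂ h₃ h₄
  rw [h₂, Pi.add_apply, h₁, h₃, Pi.smul_apply, one, h₄, h t ht, smul_eq_mul, mul_one]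

theorem conv_toL1_eq_iff (hf : Integrable f (volume.restrict (Ioc 0 b)))
    (hg : Integrable g (volume.restrict (Ioc 0 b)))
    (hh : Integrable h (volume.restrict (Ioc 0 b))) :
    conv (Integrable.toL1 f hf) (Integrable.toL1 g hg) = Integrable.toL1 h hh ↔
      ∀ᵐ t ∂volume.restrict (Ioc 0 b), (∫ s in (0 : ℝ)..t, f (t - s) * g s) = h t := by
  have h₁ : tconv b f g =ᵐ[volume.restrict (Ioc 0 b)]
      fun t => ∫ s in (0 : ℝ)..t, f (t - s) * g s :=
    (ae_restrict_mem measurableSet_Ioc).mono fun t => tconv_eq_intervalIntegral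
  rw [Lp.ext_iff]
  refine ⟨fun H => ?_, fun H => ?_⟩
  · exact h₁.symm.trans ((conv_toL1 hf hg).symm.trans (H.trans hh.coeFn_toL1))
  · exact (conv_toL1 hf hg).trans (h₁.trans (EventuallyEq.trans H hh.coeFn_toL1.symm))

theorem integrableOn_of_hasDerivWithinAt_of_le {F F' G : ℝ → ℝ}
    (hF : ∀ t ∈ Icc 0 b, HasDerivWithinAt F (F' t) (Icc 0 b) t)
    (hG : IntegrableOn G (Ioc 0 b)) (hFG : ∀ t ∈ Icc 0 b, |F' t| ≤ G t) :
    IntegrableOn F' (Ioc 0 b) := by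
  rw [integrableOn_Ioc_iff_integrableOn_Ioo] at hG ⊢
  refine Integrable.mono' hG ?_ ?_
  · refine (measurable_deriv F).aestronglyMeasurable.congr ?_
    filter_upwards [ae_restrict_mem measurableSet_Ioo] with t ht
    exact ((hF t (Ioo_subset_Icc_self ht)).hasDerivAt (Icc_mem_nhds ht.1 ht.2)).deriv
  · filter_upwards [ae_restrict_mem measurableSet_Ioo] with t ht
    exact hFG t (Ioo_subset_Icc_self ht)

theorem eq_add_integral_of_hasDerivWithinAt {F F' : ℝ → ℝ}
    (hF : ∀ t ∈ Icc 0 b, HasDerivWithinAt F (F' t) (Icc 0 b) t)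
    (hF' : IntegrableOn F' (Ioc 0 b)) {t : ℝ} (ht : t ∈ Icc 0 b) :
    F t = F 0 + ∫ s in (0 : ℝ)..t, F' s := by
  have hsub : Icc 0 t ⊆ Icc 0 b := Icc_subset_Icc_right ht.2
  rw [intervalIntegral.integral_eq_sub_of_hasDerivAt_of_le ht.1
    (fun s hs => (hF s (hsub hs)).continuousWithinAt.mono hsub)
    (fun s hs => (hF s (hsub (Ioo_subset_Icc_self hs))).hasDerivAt
      (Icc_mem_nhds hs.1 (hs.2.trans_le ht.2)))
    ((intervalIntegrable_iff_integrableOn_Ioc_of_le ht.1).2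
      (hF'.mono_set (Ioc_subset_Ioc_right ht.2)))]
  ring

theorem integrable_of_eq_add_integral {F F' : ℝ → ℝ} {c : ℝ} (hF' : IntegrableOn F' (Ioc 0 b))
    (h : ∀ t ∈ Ioc 0 b, F t = c + ∫ s in (0 : ℝ)..t, F' s) :
    Integrable F (volume.restrict (Ioc 0 b)) := by
  refine ((integrable_const c).add
    (L1.integrable_coeFn (conv (one b) (Integrable.toL1 F' hF')))).congr ?_
  filter_upwards [ae_restrict_mem measurableSet_Ioc, conv_one_toL1 hF'] with t ht h₁
  rw [Pi.add_apply, h₁, h t ht]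

end TruncConv

/-- Theorem 2.5: if `f ∈ W^{1,1}(0,b)` (represented by an absolutely continuous
function with integrable derivative), the first-kind VIE `∫₀ᵗ K(t-s)u(s)ds = f(t)` for a.e.
`t ∈ (0,b]` admits a unique solution `u ∈ L¹(0,b)` (unique up to a.e. equality). -/
theorem firstKindVIE_wellposed
    (b : ℝ) (hb : 0 < b)
    (w : ℝ → ℝ → ℝ) (hwI : WeightCondI b w) (hwII : WeightCondII b w)
    (k K : ℝ → ℝ) (g g₂ : ℝ → ℝ → ℝ) (gbar : ℝ → ℝ)
    (hWSC : WSC1 b w k K g g₂ gbar)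
    (f f' : ℝ → ℝ) (hf'int : IntegrableOn f' (Set.Ioc 0 b))
    (hf : ∀ t ∈ Set.Icc (0:ℝ) b, f t = f 0 + ∫ s in (0:ℝ)..t, f' s) :
    (∃ u : ℝ → ℝ, IntegrableOn u (Set.Ioc 0 b) ∧
      ∀ᵐ t ∂(volume.restrict (Set.Ioc (0:ℝ) b)),
        (∫ s in (0:ℝ)..t, K (t - s) * u s) = f t) ∧
    (∀ u v : ℝ → ℝ, IntegrableOn u (Set.Ioc 0 b) → IntegrableOn v (Set.Ioc 0 b) →
      (∀ᵐ t ∂(volume.restrict (Set.Ioc (0:ℝ) b)),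
        (∫ s in (0:ℝ)..t, K (t - s) * u s) = f t) →
      (∀ᵐ t ∂(volume.restrict (Set.Ioc (0:ℝ) b)),
        (∫ s in (0:ℝ)..t, K (t - s) * v s) = f t) →
      u =ᵐ[volume.restrict (Set.Ioc (0:ℝ) b)] v) := by
  obtain ⟨hk, hK, hconv, ⟨νlo, νhi, hν, -, hg0⟩, -, hgbar, hg⟩ := hWSC
  obtain ⟨w₂, wbar, -, -, hw⟩ := hwII
  have hκ : IntegrableOn (fun z => w 0 z * k z) (Set.Ioc 0 b) := by
    rw [← integrableOn_Icc_iff_integrableOn_Ioc] at hk ⊢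
    exact hk.continuousOn_mul
      (fun t ht => (hw 0 t le_rfl ht.1 ht.2).1.continuousWithinAt) isCompact_Icc
  have hder : ∀ t ∈ Set.Icc 0 b, HasDerivWithinAt (g 0) (g₂ 0 t) (Set.Icc 0 b) t := fun t ht => by
    simpa only [sub_zero] using (hg 0 t le_rfl ht.1 (by linarith [ht.2])).1
  have hg₂ : IntegrableOn (g₂ 0) (Set.Ioc 0 b) :=
    TruncConv.integrableOn_of_hasDerivWithinAt_of_le hder hgbar
      fun t ht => (hg 0 t le_rfl ht.1 (by linarith [ht.2])).2
  have hFTC : ∀ t ∈ Set.Ioc 0 b, g 0 t = g 0 0 + ∫ s in (0 : ℝ)..t, g₂ 0 s := fun t ht =>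
    TruncConv.eq_add_integral_of_hasDerivWithinAt hder hg₂ (Set.Ioc_subset_Icc_self ht)
  have hgint := TruncConv.integrable_of_eq_add_integral hg₂ hFTC
  have hf' : ∀ t ∈ Set.Ioc 0 b, f t = f 0 + ∫ s in (0 : ℝ)..t, f' s := fun t ht =>
    hf t (Set.Ioc_subset_Icc_self ht)
  have hfint := TruncConv.integrable_of_eq_add_integral hf'int hf'
  have hc : g 0 0 ≠ 0 := abs_pos.1 (hν.trans_le (hg0 0 ⟨le_rfl, hb.le⟩).1)
  have hpq : TruncConv.conv (Integrable.toL1 K hK) (Integrable.toL1 _ hκ) = _ :=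
    ((TruncConv.conv_toL1_eq_iff hK hκ hgint).2 (by
      filter_upwards [ae_restrict_mem measurableSet_Ioc] with t ht
      rw [← hconv 0 t le_rfl ht.1 (by linarith [ht.2])]
      congr 1 with z
      rw [add_zero]
      ring)).trans (TruncConv.toL1_eq_smul_one_add hgint hg₂ hFTC)
  constructor
  · obtain ⟨u, hu⟩ := TruncConv.exists_conv_eq hc hpq (f 0) (Integrable.toL1 f' hf'int)
    refine ⟨u, L1.integrable_coeFn u,
      (TruncConv.conv_toL1_eq_iff hK (L1.integrable_coeFn u) hfint).1 ?_⟩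
    rw [Integrable.toL1_coeFn, hu, TruncConv.toL1_eq_smul_one_add hfint hf'int hf']
  · intro u v hu hv hu' hv'
    refine (Integrable.toL1_eq_toL1_iff u v hu hv).1 (TruncConv.injective_conv hc hpq ?_)
    rw [(TruncConv.conv_toL1_eq_iff hK hu hfint).2 hu',
      (TruncConv.conv_toL1_eq_iff hK hv hfint).2 hv']
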